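/- arXiv:0902.2264 — 11 statements merged into one kernel-verified Lean document; each statement's English description precedes it below -/
import Mathlib

section
/- Let A be a residuated lattice and (L, λ) a reticulation of A. For any filters F and G of A, λ(F) = λ(G) (as subsets of L) if and only if F = G. -/
/-- A residuated lattice: a bounded lattice with a commutative monoid operation `mul`
(with unit `⊤`) and a residuum `himp` satisfying residuation. -/
class ResiduatedLattice (A : Type*) extends Lattice A, BoundedOrder A where
  mul : A → A → A
  himp : A → A → A
  mul_comm : ∀ a b : A, mul a b = mul b a
  mul_assoc : ∀ a b c : A, mul (mul a b) c = mul a (mul b c)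
  mul_top : ∀ a : A, mul a ⊤ = a
  residuation : ∀ a b c : A, a ≤ himp b c ↔ mul a b ≤ c

namespace ResiduatedLattice

variable {A : Type*} [ResiduatedLattice A]

/-- Powers with respect to the monoid operation `mul`. -/
def rpow (a : A) : ℕ → A
  | 0 => ⊤
  | n + 1 => mul a (rpow a n)

end ResiduatedLattice

open ResiduatedLattice

/-- A filter of a residuated lattice: a nonempty subset closed under `mul` and upward closed. -/
def IsRLFilter {A : Type*} [ResiduatedLattice A] (F : Set A) : Prop :=
  F.Nonempty ∧ (∀ a ∈ F, ∀ b ∈ F, mul a b ∈ F) ∧ ∀ a ∈ F, ∀ b : A, a ≤ b → b ∈ F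

/-- The principal filter of a residuated lattice generated by `a`:
`{b | aⁿ ≤ b for some n ≥ 1}`. -/
def rprinc {A : Type*} [ResiduatedLattice A] (a : A) : Set A :=
  {b | ∃ n : ℕ, 1 ≤ n ∧ rpow a n ≤ b}

/-- A reticulation of a residuated lattice `A`: a surjection `lam` onto a bounded
distributive lattice satisfying the five defining conditions. -/
structure IsReticulation {A L : Type*} [ResiduatedLattice A] [DistribLattice L]
    [BoundedOrder L] (lam : A → L) : Prop where
  map_mul : ∀ a b : A, lam (mul a b) = lam a ⊓ lam b
  map_sup : ∀ a b : A, lam (a ⊔ b) = lam a ⊔ lam b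
  map_bot : lam ⊥ = ⊥
  map_top : lam ⊤ = ⊤
  surj : Function.Surjective lam
  le_iff : ∀ a b : A, lam a ≤ lam b ↔ ∃ n : ℕ, 1 ≤ n ∧ rpow a n ≤ b

/-- The co-annihilator of a subset `X`: `{a | a ⊔ x = ⊤ for all x ∈ X}`. -/
def coann {A : Type*} [Lattice A] [BoundedOrder A] (X : Set A) : Set A :=
  {a | ∀ x ∈ X, a ⊔ x = ⊤}

/-- The Boolean center: the set of complemented elements. -/
def BCenter (A : Type*) [Lattice A] [BoundedOrder A] : Set A :=
  {e | ∃ f : A, e ⊓ f = ⊥ ∧ e ⊔ f = ⊤}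

theorem aux_sub {A L : Type*} [ResiduatedLattice A] [DistribLattice L] [BoundedOrder L]
    (lam : A → L) (h : IsReticulation lam) (F G : Set A)
    (hG : IsRLFilter G) (e : lam '' F ⊆ lam '' G) : F ⊆ G := by
  intro a ha
  obtain ⟨g, hg, hga⟩ := e ⟨a, ha, rfl⟩
  obtain ⟨n, -, hn⟩ := (h.le_iff g a).1 hga.le
  have hp : ∀ k : ℕ, rpow g k ∈ G := by
    intro k
    induction k with
    | zero => exact hG.2.2 g hg _ le_top
    | succ k ih => exact hG.2.1 g hg _ ih
  exact hG.2.2 _ (hp n) a hn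

/-- for a reticulation `(L, lam)` of a residuated lattice `A` and filters
`F`, `G` of `A`, `lam '' F = lam '' G` iff `F = G`. -/
theorem stmt_0 {A L : Type*} [ResiduatedLattice A] [DistribLattice L] [BoundedOrder L]
    (lam : A → L) (h : IsReticulation lam) (F G : Set A)
    (hF : IsRLFilter F) (hG : IsRLFilter G) :
    lam '' F = lam '' G ↔ F = G := by
  constructor
  · intro e
    exact Set.Subset.antisymm (aux_sub lam h F G hG e.subset) (aux_sub lam h G F hF e.symm.subset)
  · rintro rfl
    rfl
end

section
/- Let A be a residuated lattice, F a filter of A, (L, λ) a reticulation of A and (L₁, λ₁) a reticulation of the quotient residuated lattice A/F. Then the map h : L/λ(F) → L₁ defined by h(λ(a)/λ(F)) = λ₁(a/F) for all a ∈ A is a well-defined surjective morphism of bounded lattices. -/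
open ResiduatedLattice

/-- The congruence relation on a lattice induced by a lattice filter `G`:
`a ≡ b (mod G)` iff `a ⊓ e = b ⊓ e` for some `e ∈ G`. -/
def latticeFilterRel {L : Type*} [Lattice L] (G : Set L) (a b : L) : Prop :=
  ∃ e ∈ G, a ⊓ e = b ⊓ e

/-- let `A` be a residuated lattice, `F` a filter of `A`, `(LA, lam)` a
reticulation of `A` and `(LQ, lam₁)` a reticulation of the quotient `A/F` (presented
by its quotient map `π : A → Q`, a surjective residuated lattice morphism identifying
exactly the pairs congruent modulo `F`). Then the map `h : LA/lam(F) → LQ` given by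
`h(lam(a)/lam(F)) = lam₁(π a)` is a well-defined surjective bounded lattice
morphism. -/
theorem stmt_5 {A Q LA LQ : Type*} [ResiduatedLattice A] [ResiduatedLattice Q]
    [DistribLattice LA] [BoundedOrder LA] [DistribLattice LQ] [BoundedOrder LQ]
    (lam : A → LA) (hlam : IsReticulation lam)
    (F : Set A) (hF : IsRLFilter F)
    (π : A → Q) (hπsurj : Function.Surjective π)
    (hπsup : ∀ a b : A, π (a ⊔ b) = π a ⊔ π b)
    (hπinf : ∀ a b : A, π (a ⊓ b) = π a ⊓ π b)
    (hπmul : ∀ a b : A, π (mul a b) = mul (π a) (π b))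
    (hπhimp : ∀ a b : A, π (himp a b) = himp (π a) (π b))
    (hπbot : π ⊥ = ⊥) (hπtop : π ⊤ = ⊤)
    (hπker : ∀ a b : A, π a = π b ↔ himp a b ⊓ himp b a ∈ F)
    (lam₁ : Q → LQ) (hlam₁ : IsReticulation lam₁) :
    ∃ h : Quot (latticeFilterRel (lam '' F)) → LQ,
      (∀ a : A, h (Quot.mk _ (lam a)) = lam₁ (π a)) ∧
      Function.Surjective h ∧
      (∀ a b : A, h (Quot.mk _ (lam a ⊓ lam b)) =
        h (Quot.mk _ (lam a)) ⊓ h (Quot.mk _ (lam b))) ∧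
      (∀ a b : A, h (Quot.mk _ (lam a ⊔ lam b)) =
        h (Quot.mk _ (lam a)) ⊔ h (Quot.mk _ (lam b))) ∧
      h (Quot.mk _ ⊥) = ⊥ ∧ h (Quot.mk _ ⊤) = ⊤ := by
  have hpow : ∀ (a : A) (n : ℕ), π (rpow a n) = rpow (π a) n := by
    intro a n
    induction n with
    | zero => exact hπtop
    | succ k ih => simp only [rpow, hπmul, ih]
  have hmono : ∀ a b : A, lam a ≤ lam b → lam₁ (π a) ≤ lam₁ (π b) := by
    intro a b hab
    obtain ⟨n, hn, hle⟩ := (hlam.le_iff a b).1 hab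
    refine (hlam₁.le_iff _ _).2 ⟨n, hn, ?_⟩
    rw [← hpow, ← sup_eq_right, ← hπsup, sup_eq_right.2 hle]
  have heq : ∀ a b : A, lam a = lam b → lam₁ (π a) = lam₁ (π b) := fun a b hab =>
    le_antisymm (hmono a b hab.le) (hmono b a hab.ge)
  have hFtop : ∀ f ∈ F, π f = ⊤ := by
    intro f hf
    rw [← hπtop, hπker]
    refine hF.2.2 f hf _ (le_inf ?_ ?_)
    · exact (residuation _ _ _).2 le_top
    · exact (residuation _ _ _).2 (mul_top f).le
  have hwd : ∀ a b : A, latticeFilterRel (lam '' F) (lam a) (lam b) →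
      lam₁ (π a) = lam₁ (π b) := by
    rintro a b ⟨_, ⟨f, hf, rfl⟩, he⟩
    rw [← hlam.map_mul, ← hlam.map_mul] at he
    have h2 := heq _ _ he
    rwa [hπmul, hπmul, hFtop f hf, mul_top, mul_top] at h2
  have hs := Function.surjInv_eq hlam.surj
  let h : Quot (latticeFilterRel (lam '' F)) → LQ :=
    Quot.lift (fun l => lam₁ (π (Function.surjInv hlam.surj l))) (by
      intro l m hlm
      apply hwd
      rwa [hs, hs])
  have hh : ∀ a : A, h (Quot.mk _ (lam a)) = lam₁ (π a) := fun a => heq _ _ (hs _)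
  refine ⟨h, hh, ?_, ?_, ?_, ?_, ?_⟩
  · intro y
    obtain ⟨q, rfl⟩ := hlam₁.surj y
    obtain ⟨a, rfl⟩ := hπsurj q
    exact ⟨Quot.mk _ (lam a), hh a⟩
  · intro a b
    rw [← hlam.map_mul, hh, hh, hh, hπmul, hlam₁.map_mul]
  · intro a b
    rw [← hlam.map_sup, hh, hh, hh, hπsup, hlam₁.map_sup]
  · rw [← hlam.map_bot, hh, hπbot, hlam₁.map_bot]
  · rw [← hlam.map_top, hh, hπtop, hlam₁.map_top]
end

section
/- The reticulation functor preserves inductive limits: let (I, ≤) be a directed set, ((Aᵢ)ᵢ∈I, (φᵢⱼ)ᵢ≤ⱼ) an inductive system of residuated lattices and residuated lattice morphisms, and (A, (φᵢ)ᵢ∈I) its inductive limit in the category of residuated lattices. For each i let (L(Aᵢ), λᵢ) be a reticulation of Aᵢ and let (L(A), λ) be a reticulation of A; let L(φᵢⱼ) : L(Aᵢ) → L(Aⱼ) and L(φᵢ) : L(Aᵢ) → L(A) be the induced bounded lattice morphisms determined by L(φᵢⱼ)(λᵢ(a)) = λⱼ(φᵢⱼ(a)) and L(φᵢ)(λᵢ(a))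 = λ(φᵢ(a)). Then (L(A), (L(φᵢ))ᵢ∈I) is an inductive limit of the inductive system ((L(Aᵢ))ᵢ∈I, (L(φᵢⱼ))ᵢ≤ⱼ) in the category of bounded distributive lattices: L(φⱼ) ∘ L(φᵢⱼ) = L(φᵢ) for i ≤ j, and for every bounded distributive lattice M and every family of bounded lattice morphisms fᵢ : L(Aᵢ) → M with fⱼ ∘ L(φᵢⱼ) = fᵢ for all i ≤ j, there exists a unique bounded lattice morphism f : L(A) → M with f ∘ L(φᵢ) = fᵢ for all i ∈ I. -/
open ResiduatedLattice

/-- A bundled residuated lattice. -/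
structure RLPack : Type 1 where
  carrier : Type
  [str : ResiduatedLattice carrier]

attribute [instance] RLPack.str

/-- A bundled bounded distributive lattice. -/
structure BDLPack : Type 1 where
  carrier : Type
  [distrib : DistribLattice carrier]
  [bdd : BoundedOrder carrier]

attribute [instance] BDLPack.distrib BDLPack.bdd

/-- A morphism of residuated lattices. -/
def IsRLHom {A B : Type*} [ResiduatedLattice A] [ResiduatedLattice B] (f : A → B) : Prop :=
  (∀ a b, f (a ⊔ b) = f a ⊔ f b) ∧ (∀ a b, f (a ⊓ b) = f a ⊓ f b) ∧
  (∀ a b, f (mul a b) = mul (f a) (f b)) ∧ (∀ a b, f (himp a b) = himp (f a) (f b)) ∧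
  f ⊥ = ⊥ ∧ f ⊤ = ⊤

/-- A morphism of bounded lattices. -/
def IsBDLHom {L M : Type*} [Lattice L] [BoundedOrder L] [Lattice M] [BoundedOrder M]
    (f : L → M) : Prop :=
  (∀ a b, f (a ⊔ b) = f a ⊔ f b) ∧ (∀ a b, f (a ⊓ b) = f a ⊓ f b) ∧ f ⊥ = ⊥ ∧ f ⊤ = ⊤

namespace S6

/-- A subset closed under the operations. -/
structure Closed {A : Type} [ResiduatedLattice A] (S : A → Prop) : Prop where
  sup : ∀ a b, S a → S b → S (a ⊔ b)
  inf : ∀ a b, S a → S b → S (a ⊓ b)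
  mul : ∀ a b, S a → S b → S (mul a b)
  himp : ∀ a b, S a → S b → S (himp a b)
  bot : S ⊥
  top : S ⊤

/-- Subalgebra structure. -/
@[reducible] def subRL {A : Type} [ResiduatedLattice A] (S : A → Prop) (h : Closed S) :
    ResiduatedLattice {a // S a} :=
  { Subtype.lattice (P := S) (fun _ _ ha hb => h.sup _ _ ha hb) (fun _ _ ha hb => h.inf _ _ ha hb) with
    top := ⟨⊤, h.top⟩
    bot := ⟨⊥, h.bot⟩
    le_top := fun a => le_top (a := a.1)
    bot_le := fun a => bot_le (a := a.1)
    mul := fun a b => ⟨mul a.1 b.1, h.mul _ _ a.2 b.2⟩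
    himp := fun a b => ⟨himp a.1 b.1, h.himp _ _ a.2 b.2⟩
    mul_comm := fun a b => Subtype.ext (mul_comm a.1 b.1)
    mul_assoc := fun a b c => Subtype.ext (mul_assoc a.1 b.1 c.1)
    mul_top := fun a => Subtype.ext (mul_top a.1)
    residuation := fun a b c => residuation a.1 b.1 c.1 }

/-- Bool as a residuated lattice. -/
@[reducible] noncomputable def boolRL : ResiduatedLattice Bool :=
  { (inferInstance : Lattice Bool), (inferInstance : BoundedOrder Bool) with
    mul := fun a b => a && b
    himp := fun a b => !a || b
    mul_comm := by decide
    mul_assoc := by decide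
    mul_top := by decide
    residuation := by decide }

/-- Eventual equality. -/
def evSetoid {I : Type} [Preorder I] (A : I → RLPack) : Setoid (∀ i, (A i).carrier) where
  r x y := ∀ᶠ i in Filter.atTop, x i = y i
  iseqv := ⟨fun _ => Filter.Eventually.of_forall fun _ => rfl,
    fun h => h.mono fun _ e => e.symm,
    fun h h' => (h.and h').mono fun _ e => e.1.trans e.2⟩

/-- Germs at infinity. -/
def Germ {I : Type} [Preorder I] (A : I → RLPack) : Type := Quotient (evSetoid A)

/-- Pointwise operation on germs. -/
def op {I : Type} [Preorder I] {A : I → RLPack}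
    (o : ∀ i, (A i).carrier → (A i).carrier → (A i).carrier) :
    Germ A → Germ A → Germ A :=
  Quotient.map₂ (fun x y i => o i (x i) (y i))
    (fun _ _ h _ _ h' => (Filter.Eventually.and h h').mono fun i e => by
      show o i _ _ = o i _ _
      rw [e.1, e.2])

def gmk {I : Type} [Preorder I] {A : I → RLPack} (x : ∀ i, (A i).carrier) : Germ A :=
  Quotient.mk (evSetoid A) x

theorem gmk_eq {I : Type} [Preorder I] {A : I → RLPack} {x y : ∀ i, (A i).carrier} :
    gmk x = gmk y ↔ ∀ᶠ i in Filter.atTop, x i = y i :=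
  ⟨fun h => Quotient.exact h, fun h => Quotient.sound h⟩

theorem gmk_of {I : Type} [Preorder I] {A : I → RLPack} {x y : ∀ i, (A i).carrier}
    (h : ∀ i, x i = y i) : gmk x = gmk y := congrArg gmk (funext h)

theorem gind {I : Type} [Preorder I] {A : I → RLPack} {p : Germ A → Prop}
    (h : ∀ x, p (gmk x)) (a : Germ A) : p a := Quotient.ind h a

@[reducible] def germLat {I : Type} [Preorder I] (A : I → RLPack) : Lattice (Germ A) :=
  letI : Max (Germ A) := ⟨op fun _ a b => a ⊔ b⟩
  letI : Min (Germ A) := ⟨op fun _ a b => a ⊓ b⟩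
  Lattice.mk'
    (gind fun _ => gind fun _ => gmk_of fun _ => sup_comm _ _)
    (gind fun _ => gind fun _ => gind fun _ => gmk_of fun _ => sup_assoc _ _ _)
    (gind fun _ => gind fun _ => gmk_of fun _ => inf_comm _ _)
    (gind fun _ => gind fun _ => gind fun _ => gmk_of fun _ => inf_assoc _ _ _)
    (gind fun _ => gind fun _ => gmk_of fun _ => sup_inf_self)
    (gind fun _ => gind fun _ => gmk_of fun _ => inf_sup_self)

theorem germ_le {I : Type} [Preorder I] {A : I → RLPack} (x y : ∀ i, (A i).carrier) :
    (germLat A).le (gmk x) (gmk y) ↔ ∀ᶠ i in Filter.atTop, x i ≤ y i := by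
  letI := germLat A
  have : (gmk x ≤ gmk y) ↔ gmk (fun i => x i ⊔ y i) = gmk y := sup_eq_right.symm
  refine this.trans (gmk_eq.trans ?_)
  simp only [sup_eq_right]

@[reducible] def germRL {I : Type} [Preorder I] (A : I → RLPack) : ResiduatedLattice (Germ A) :=
  { germLat A with
    top := gmk fun _ => ⊤
    bot := gmk fun _ => ⊥
    le_top := gind fun x => (germ_le _ _).2 (Filter.Eventually.of_forall fun _ => le_top)
    bot_le := gind fun x => (germ_le _ _).2 (Filter.Eventually.of_forall fun _ => bot_le)
    mul := op fun _ a b => mul a b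
    himp := op fun _ a b => himp a b
    mul_comm := gind fun _ => gind fun _ => gmk_of fun _ => mul_comm _ _
    mul_assoc := gind fun _ => gind fun _ => gind fun _ => gmk_of fun _ => mul_assoc _ _ _
    mul_top := gind fun _ => gmk_of fun _ => mul_top _
    residuation := gind fun x => gind fun y => gind fun z => by
      refine (germ_le x (fun i => himp (y i) (z i))).trans
        (Iff.trans ?_ (germ_le (fun i => mul (x i) (y i)) z).symm)
      simp only [residuation] }

theorem mul_mono_left {A : Type} [ResiduatedLattice A] {a b : A} (c : A) (h : a ≤ b) :
    mul a c ≤ mul b c :=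
  (residuation _ _ _).1 (h.trans ((residuation _ _ _).2 le_rfl))

theorem bot_mul {A : Type} [ResiduatedLattice A] (a : A) : mul (⊥ : A) a = ⊥ :=
  le_bot_iff.1 ((residuation _ _ _).1 bot_le)

theorem bot_himp {A : Type} [ResiduatedLattice A] (a : A) : himp (⊥ : A) a = ⊤ :=
  top_le_iff.1 ((residuation _ _ _).2 (by rw [ResiduatedLattice.mul_comm, bot_mul]; exact bot_le))

theorem top_himp {A : Type} [ResiduatedLattice A] (a : A) : himp (⊤ : A) a = a := by
  apply le_antisymm
  · have := (residuation (himp ⊤ a) ⊤ a).1 le_rfl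
    rwa [mul_top] at this
  · rw [residuation, mul_top]

theorem rpow_top {A : Type} [ResiduatedLattice A] (n : ℕ) : rpow (⊤ : A) n = ⊤ := by
  induction n with
  | zero => rfl
  | succ n ih => rw [rpow, ih, mul_top]

theorem hom_rpow {A B : Type} [ResiduatedLattice A] [ResiduatedLattice B] {f : A → B}
    (hf : IsRLHom f) (a : A) (n : ℕ) : f (rpow a n) = rpow (f a) n := by
  induction n with
  | zero => exact hf.2.2.2.2.2
  | succ n ih => rw [rpow, rpow, hf.2.2.1, ih]

theorem hom_le {A B : Type} [ResiduatedLattice A] [ResiduatedLattice B] {f : A → B}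
    (hf : IsRLHom f) {a b : A} (h : a ≤ b) : f a ≤ f b := by
  rw [← sup_eq_right, ← hf.1, sup_eq_right.2 h]

theorem bhom_le {A B : Type} [DistribLattice A] [BoundedOrder A] [DistribLattice B]
    [BoundedOrder B] {f : A → B}
    (hf : IsBDLHom f) {a b : A} (h : a ≤ b) : f a ≤ f b := by
  rw [← sup_eq_right, ← hf.1, sup_eq_right.2 h]

section
variable {I : Type} [Preorder I]
    (A : I → RLPack)
    (φij : ∀ i j : I, i ≤ j → (A i).carrier → (A j).carrier)
    (Alim : RLPack) (φ : ∀ i : I, (A i).carrier → Alim.carrier)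

theorem gen
    (hφhom : ∀ i, IsRLHom (φ i))
    (hφcoc : ∀ i j (h : i ≤ j), φ j ∘ φij i j h = φ i)
    (huniv : ∀ (B : RLPack) (f : ∀ i : I, (A i).carrier → B.carrier),
      (∀ i, IsRLHom (f i)) → (∀ i j (h : i ≤ j), f j ∘ φij i j h = f i) →
      ∃! g : Alim.carrier → B.carrier, IsRLHom g ∧ ∀ i, g ∘ φ i = f i)
    (S : Alim.carrier → Prop) (hS : Closed S) (hφS : ∀ i x, S (φ i x)) (a) : S a := by
  letI := subRL S hS
  obtain ⟨g, ⟨hg, hgφ⟩, -⟩ := huniv ⟨{a // S a}⟩ (fun i x => ⟨φ i x, hφS i x⟩)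
    (fun i => by
      obtain ⟨h1, h2, h3, h4, h5, h6⟩ := hφhom i
      exact ⟨fun a b => Subtype.ext (h1 a b), fun a b => Subtype.ext (h2 a b),
        fun a b => Subtype.ext (h3 a b), fun a b => Subtype.ext (h4 a b),
        Subtype.ext h5, Subtype.ext h6⟩)
    (fun i j h => funext fun x => Subtype.ext (congrFun (hφcoc i j h) x))
  have e := (huniv Alim φ hφhom hφcoc).unique (y₁ := fun a => (g a).1) (y₂ := id)
    ⟨by
      obtain ⟨h1, h2, h3, h4, h5, h6⟩ := hg
      exact ⟨fun a b => congrArg Subtype.val (h1 a b), fun a b => congrArg Subtype.val (h2 a b),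
        fun a b => congrArg Subtype.val (h3 a b), fun a b => congrArg Subtype.val (h4 a b),
        congrArg Subtype.val h5, congrArg Subtype.val h6⟩,
      fun i => funext fun x => congrArg Subtype.val (congrFun (hgφ i) x)⟩
    ⟨⟨fun _ _ => rfl, fun _ _ => rfl, fun _ _ => rfl, fun _ _ => rfl, rfl, rfl⟩, fun _ => rfl⟩
  have := congrFun e a
  simp only [id] at this
  rw [← this]
  exact (g a).2

open Classical in
theorem inj (hdir : ∀ i j : I, ∃ k : I, i ≤ k ∧ j ≤ k)
    (hφijhom : ∀ i j (h : i ≤ j), IsRLHom (φij i j h))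
    (hφijcomp : ∀ i j k (hij : i ≤ j) (hjk : j ≤ k),
      φij j k hjk ∘ φij i j hij = φij i k (le_trans hij hjk))
    (huniv : ∀ (B : RLPack) (f : ∀ i : I, (A i).carrier → B.carrier),
      (∀ i, IsRLHom (f i)) → (∀ i j (h : i ≤ j), f j ∘ φij i j h = f i) →
      ∃! g : Alim.carrier → B.carrier, IsRLHom g ∧ ∀ i, g ∘ φ i = f i)
    (i : I) (x y : (A i).carrier) (hxy : φ i x ≤ φ i y) :
    ∃ j, ∃ h : i ≤ j, φij i j h x ≤ φij i j h y := by
  haveI : Nonempty I := ⟨i⟩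
  haveI : IsDirectedOrder I := ⟨hdir⟩
  letI := germRL A
  let F : ∀ i : I, (A i).carrier → ∀ k, (A k).carrier :=
    fun i x k => if h : i ≤ k then φij i k h x else ⊥
  have key : ∀ i (x : (A i).carrier) k (h : i ≤ k), F i x k = φij i k h x :=
    fun i x k h => dif_pos h
  obtain ⟨g, ⟨hg, hgφ⟩, -⟩ := huniv ⟨Germ A⟩ (fun i x => gmk (F i x))
    (fun i => by
      refine ⟨fun a b => gmk_eq.2 ?_, fun a b => gmk_eq.2 ?_, fun a b => gmk_eq.2 ?_,
        fun a b => gmk_eq.2 ?_, gmk_eq.2 ?_, gmk_eq.2 ?_⟩ <;>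
      filter_upwards [Filter.eventually_ge_atTop i] with k hk <;>
      obtain ⟨h1, h2, h3, h4, h5, h6⟩ := hφijhom i k hk <;>
      simp only [key _ _ k hk, h1, h2, h3, h4, h5, h6])
    (fun i j h => funext fun x => gmk_eq.2 (by
      filter_upwards [Filter.eventually_ge_atTop j] with k hk
      rw [key _ _ k hk, key _ _ k (h.trans hk), ← hφijcomp i j k h hk]; rfl))
  have h1 := hom_le hg hxy
  have e1 := congrFun (hgφ i) x
  have e2 := congrFun (hgφ i) y
  simp only [Function.comp] at e1 e2
  rw [e1, e2] at h1
  have h2 := (germ_le _ _).1 h1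
  obtain ⟨k, hk, hik⟩ := (h2.and (Filter.eventually_ge_atTop i)).exists
  exact ⟨k, hik, by rwa [key _ _ k hik, key _ _ k hik] at hk⟩

end
end S6

/-- the reticulation functor preserves inductive limits. Let `(I, ≤)` be
a directed set, `(Aᵢ, φᵢⱼ)` an inductive system of residuated lattices and
`(Alim, φᵢ)` its inductive limit in the category of residuated lattices. Let
`(LAᵢ, lamᵢ)` be reticulations of the `Aᵢ`, `(Llim, lamlim)` a reticulation of
`Alim`, and let `Lφᵢⱼ`, `Lφᵢ` be the induced bounded lattice morphisms, determined
by `Lφᵢⱼ(lamᵢ a) = lamⱼ(φᵢⱼ a)` and `Lφᵢ(lamᵢ a) = lamlim(φᵢ a)`. Then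
`(Llim, (Lφᵢ))` is an inductive limit of the inductive system `(LAᵢ, Lφᵢⱼ)` in the
category of bounded distributive lattices. -/
theorem stmt_6 {I : Type} [Preorder I]
    (hdir : ∀ i j : I, ∃ k : I, i ≤ k ∧ j ≤ k)
    (A : I → RLPack)
    (φij : ∀ i j : I, i ≤ j → (A i).carrier → (A j).carrier)
    (hφijhom : ∀ i j (h : i ≤ j), IsRLHom (φij i j h))
    (hφijid : ∀ i : I, φij i i le_rfl = id)
    (hφijcomp : ∀ i j k (hij : i ≤ j) (hjk : j ≤ k),
      φij j k hjk ∘ φij i j hij = φij i k (le_trans hij hjk))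
    (Alim : RLPack) (φ : ∀ i : I, (A i).carrier → Alim.carrier)
    (hφhom : ∀ i, IsRLHom (φ i))
    (hφcoc : ∀ i j (h : i ≤ j), φ j ∘ φij i j h = φ i)
    (huniv : ∀ (B : RLPack) (f : ∀ i : I, (A i).carrier → B.carrier),
      (∀ i, IsRLHom (f i)) → (∀ i j (h : i ≤ j), f j ∘ φij i j h = f i) →
      ∃! g : Alim.carrier → B.carrier, IsRLHom g ∧ ∀ i, g ∘ φ i = f i)
    (LA : I → BDLPack)
    (lam : ∀ i : I, (A i).carrier → (LA i).carrier)
    (hlam : ∀ i, IsReticulation (lam i))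
    (Llim : BDLPack) (lamlim : Alim.carrier → Llim.carrier)
    (hlamlim : IsReticulation lamlim)
    (Lφij : ∀ i j : I, i ≤ j → (LA i).carrier → (LA j).carrier)
    (hLφijhom : ∀ i j (h : i ≤ j), IsBDLHom (Lφij i j h))
    (hLφijdef : ∀ i j (h : i ≤ j) (a : (A i).carrier),
      Lφij i j h (lam i a) = lam j (φij i j h a))
    (Lφ : ∀ i : I, (LA i).carrier → Llim.carrier)
    (hLφhom : ∀ i, IsBDLHom (Lφ i))
    (hLφdef : ∀ i (a : (A i).carrier), Lφ i (lam i a) = lamlim (φ i a)) :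
    (∀ i j (h : i ≤ j), Lφ j ∘ Lφij i j h = Lφ i) ∧
    ∀ (M : BDLPack) (f : ∀ i : I, (LA i).carrier → M.carrier),
      (∀ i, IsBDLHom (f i)) → (∀ i j (h : i ≤ j), f j ∘ Lφij i j h = f i) →
      ∃! g : Llim.carrier → M.carrier, IsBDLHom g ∧ ∀ i, g ∘ Lφ i = f i := by
  have hcoc : ∀ i j (h : i ≤ j), Lφ j ∘ Lφij i j h = Lφ i := by
    intro i j h
    funext p
    obtain ⟨x, rfl⟩ := (hlam i).surj p
    simp only [Function.comp, hLφijdef, hLφdef]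
    rw [← hφcoc i j h]; rfl
  refine ⟨hcoc, ?_⟩
  intro M f hf hfc
  have hgen := S6.gen A φij Alim φ hφhom hφcoc huniv
  rcases isEmpty_or_nonempty I with hI | hI
  · have hbt : ∀ a : Alim.carrier, a = ⊥ ∨ a = ⊤ := by
      apply hgen (fun a => a = ⊥ ∨ a = ⊤)
      · constructor
        · rintro a b (rfl | rfl) (rfl | rfl) <;> simp
        · rintro a b (rfl | rfl) (rfl | rfl) <;> simp
        · rintro a b (rfl | rfl) hb
          · exact Or.inl (S6.bot_mul b)
          · show mul ⊤ b = ⊥ ∨ mul ⊤ b = ⊤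
            rw [ResiduatedLattice.mul_comm, ResiduatedLattice.mul_top]
            exact hb
        · rintro a b (rfl | rfl) (rfl | rfl) <;> simp [S6.bot_himp, S6.top_himp]
        · exact Or.inl rfl
        · exact Or.inr rfl
      · exact fun i => isEmptyElim i
    have hne : (⊥ : Alim.carrier) ≠ ⊤ := by
      letI := S6.boolRL
      obtain ⟨g, ⟨hg, -⟩, -⟩ := huniv ⟨Bool⟩ (fun i => isEmptyElim i)
        (fun i => isEmptyElim i) (fun i => isEmptyElim i)
      intro h
      have h5 := hg.2.2.2.2.1
      have h6 := hg.2.2.2.2.2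
      rw [h, h6] at h5
      exact absurd h5 (by decide)
    have hLbt : ∀ u : Llim.carrier, u = ⊥ ∨ u = ⊤ := by
      intro u
      obtain ⟨a, rfl⟩ := hlamlim.surj u
      rcases hbt a with rfl | rfl
      · exact Or.inl hlamlim.map_bot
      · exact Or.inr hlamlim.map_top
    have hLne : (⊥ : Llim.carrier) ≠ ⊤ := by
      intro h
      rw [← hlamlim.map_bot, ← hlamlim.map_top] at h
      obtain ⟨n, -, hn⟩ := (hlamlim.le_iff _ _).1 h.ge
      rw [S6.rpow_top] at hn
      exact hne (top_le_iff.1 hn)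
    classical
    refine ⟨fun u => if u = ⊤ then ⊤ else ⊥, ⟨⟨?_, ?_, ?_, ?_⟩, fun i => isEmptyElim i⟩, ?_⟩
    · intro a b
      rcases hLbt a with rfl | rfl <;> rcases hLbt b with rfl | rfl <;> simp [hLne]
    · intro a b
      rcases hLbt a with rfl | rfl <;> rcases hLbt b with rfl | rfl <;> simp [hLne]
    · simp [hLne]
    · simp
    · rintro g ⟨hg, -⟩
      funext u
      rcases hLbt u with rfl | rfl
      · simp [hLne, hg.2.2.1]
      · simp [hg.2.2.2]
  have hinj := S6.inj A φij Alim φ hdir hφijhom hφijcomp huniv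
  have hcx : ∀ i j (h : i ≤ j) x, φ j (φij i j h x) = φ i x :=
    fun i j h x => congrFun (hφcoc i j h) x
  have hLcx : ∀ i j (h : i ≤ j) x, Lφ j (Lφij i j h x) = Lφ i x :=
    fun i j h x => congrFun (hcoc i j h) x
  have hfx : ∀ i j (h : i ≤ j) x, f j (Lφij i j h x) = f i x :=
    fun i j h x => congrFun (hfc i j h) x
  have hsurj : ∀ a : Alim.carrier, ∃ i x, φ i x = a := by
    have hop : ∀ (o : ∀ B : RLPack, B.carrier → B.carrier → B.carrier),
        (∀ i x y, φ i (o _ x y) = o _ (φ i x) (φ i y)) → ∀ a b : Alim.carrier,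
        (∃ i x, φ i x = a) → (∃ i x, φ i x = b) → ∃ i x, φ i x = o _ a b := by
      rintro o ho _ _ ⟨i, x, rfl⟩ ⟨j, y, rfl⟩
      obtain ⟨k, hi, hj⟩ := hdir i j
      exact ⟨k, o _ (φij i k hi x) (φij j k hj y), by rw [ho, hcx, hcx]⟩
    obtain ⟨i0⟩ := hI
    apply hgen (fun a => ∃ i x, φ i x = a)
    · exact ⟨hop (fun _ a b => a ⊔ b) fun i => (hφhom i).1,
        hop (fun _ a b => a ⊓ b) fun i => (hφhom i).2.1,
        hop (fun _ a b => mul a b) fun i => (hφhom i).2.2.1,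
        hop (fun _ a b => himp a b) fun i => (hφhom i).2.2.2.1,
        ⟨i0, ⊥, (hφhom i0).2.2.2.2.1⟩, ⟨i0, ⊤, (hφhom i0).2.2.2.2.2⟩⟩
    · exact fun i x => ⟨i, x, rfl⟩
  have hLsurj : ∀ u : Llim.carrier, ∃ i p, Lφ i p = u := by
    intro u
    obtain ⟨a, rfl⟩ := hlamlim.surj u
    obtain ⟨i, x, rfl⟩ := hsurj a
    exact ⟨i, lam i x, hLφdef i x⟩
  have hk1 : ∀ k p q, Lφ k p ≤ Lφ k q → f k p ≤ f k q := by
    intro k p q h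
    obtain ⟨x, rfl⟩ := (hlam k).surj p
    obtain ⟨y, rfl⟩ := (hlam k).surj q
    rw [hLφdef, hLφdef, hlamlim.le_iff] at h
    obtain ⟨n, hn, h⟩ := h
    rw [← S6.hom_rpow (hφhom k)] at h
    obtain ⟨l, hl, h⟩ := hinj k _ _ h
    rw [S6.hom_rpow (hφijhom k l hl)] at h
    have := S6.bhom_le (hf l) (((hlam l).le_iff _ _).2 ⟨n, hn, h⟩)
    rwa [← hLφijdef, ← hLφijdef, hfx, hfx] at this
  have hk : ∀ i j p q, Lφ i p = Lφ j q → f i p = f j q := by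
    intro i j p q h
    obtain ⟨k, hi, hj⟩ := hdir i j
    rw [← hLcx i k hi, ← hLcx j k hj] at h
    rw [← hfx i k hi, ← hfx j k hj]
    exact le_antisymm (hk1 _ _ _ h.le) (hk1 _ _ _ h.ge)
  choose ι π hπ using hLsurj
  have hg : ∀ i p, f (ι (Lφ i p)) (π (Lφ i p)) = f i p := fun i p => hk _ _ _ _ (hπ _)
  have hg2 : ∀ u i p, Lφ i p = u → f (ι u) (π u) = f i p := by
    rintro _ i p rfl
    exact hg i p
  have hpair : ∀ u v : Llim.carrier, ∃ k p q, Lφ k p = u ∧ Lφ k q = v := by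
    intro u v
    obtain ⟨k, hi, hj⟩ := hdir (ι u) (ι v)
    exact ⟨k, Lφij _ k hi (π u), Lφij _ k hj (π v), by rw [hLcx, hπ], by rw [hLcx, hπ]⟩
  obtain ⟨i0⟩ := hI
  refine ⟨fun u => f (ι u) (π u), ⟨⟨?_, ?_, ?_, ?_⟩, fun i => funext fun p => hg i p⟩, ?_⟩
  · intro a b
    obtain ⟨k, p, q, rfl, rfl⟩ := hpair a b
    exact (hg2 _ k (p ⊔ q) ((hLφhom k).1 p q)).trans (by simp only [hg, (hf k).1])
  · intro a b
    obtain ⟨k, p, q, rfl, rfl⟩ := hpair a b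
    exact (hg2 _ k (p ⊓ q) ((hLφhom k).2.1 p q)).trans (by simp only [hg, (hf k).2.1])
  · exact (hg2 _ i0 ⊥ (hLφhom i0).2.2.1).trans (hf i0).2.2.1
  · exact (hg2 _ i0 ⊤ (hLφhom i0).2.2.2).trans (hf i0).2.2.2
  · rintro g ⟨-, hgc⟩
    funext u
    conv_lhs => rw [← hπ u]
    exact congrFun (hgc _) _
end

section
/- The reticulation functor preserves Boolean powers: if A is a residuated lattice, B is a Boolean algebra, and (L(A), λ) is a reticulation of A, then the reticulation of the Boolean power A[B] is isomorphic as a bounded distributive lattice to the Boolean power L(A)[B]. -/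
open ResiduatedLattice

/-- The Boolean power `A[B]`: functions `X : A → B` with finite image, whose values
form a partition of unity (`⋁_{a} X a = 1`, expressed as a least upper bound, and
`X a ⊓ X b = 0` for `a ≠ b`). -/
def BoolPow (A B : Type*) [BooleanAlgebra B] : Type _ :=
  {X : A → B // (Set.range X).Finite ∧ IsLUB (Set.range X) ⊤ ∧
    ∀ a b : A, a ≠ b → X a ⊓ X b = ⊥}

/-- `Z` is the value of the Boolean-power operation induced by the binary operation
`f` on the arguments `X, Y`: `Z a = ⋁ {X a₁ ⊓ Y a₂ | f a₁ a₂ = a}` (each such join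
expressed as a least upper bound). -/
def IsBPOp {A B : Type*} [BooleanAlgebra B] (f : A → A → A) (X Y Z : A → B) : Prop :=
  ∀ a : A, IsLUB {p : B | ∃ a₁ a₂ : A, f a₁ a₂ = a ∧ p = X a₁ ⊓ Y a₂} (Z a)

/-- `Z` is the element of the Boolean power corresponding to the constant `c`:
the characteristic function of `c`. -/
def IsBPConst {A B : Type*} [BooleanAlgebra B] (c : A) (Z : A → B) : Prop :=
  Z c = ⊤ ∧ ∀ a : A, a ≠ c → Z a = ⊥

/-- Points of a Boolean algebra. -/
structure BPt (B : Type*) [BooleanAlgebra B] where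
  p : B → Prop
  top : p ⊤
  bot : ¬ p ⊥
  inf : ∀ a b, p (a ⊓ b) ↔ p a ∧ p b
  sup : ∀ a b, p (a ⊔ b) ↔ p a ∨ p b

namespace BPt

variable {B : Type*} [BooleanAlgebra B]

theorem mono (φ : BPt B) {a b : B} (h : a ≤ b) (ha : φ.p a) : φ.p b := by
  have := φ.inf a b
  rw [inf_eq_left.2 h] at this
  exact (this.1 ha).2

theorem sep {b c : B} (h : ∀ φ : BPt B, φ.p b → φ.p c) : b ≤ c := by
  by_contra hbc
  have hd : Disjoint (Order.PFilter.principal b : Set B) (Order.Ideal.principal c : Set B) := by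
    rw [Set.disjoint_left]
    intro x hx hx'
    exact hbc (le_trans (Order.PFilter.mem_principal.1 hx) (Order.Ideal.mem_principal.1 hx'))
  obtain ⟨J, hJ, hcJ, hdJ⟩ := DistribLattice.prime_ideal_of_disjoint_filter_ideal hd
  have hb : b ∉ J := fun hb =>
    Set.disjoint_left.1 hdJ (show b ∈ (Order.PFilter.principal b : Set B) from
      Order.PFilter.mem_principal.2 le_rfl) hb
  have hc : c ∈ J := hcJ (show c ∈ (Order.Ideal.principal c : Set B) from
      Order.Ideal.mem_principal.2 le_rfl)
  have htop : ⊤ ∉ J := fun ht => hb (J.lower le_top ht)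
  refine h ⟨fun x => x ∉ J, htop, fun hn => hn J.bot_mem, ?_, ?_⟩ hb hc
  · intro x y
    constructor
    · intro hxy
      exact ⟨fun hx => hxy (J.lower inf_le_left hx), fun hy => hxy (J.lower inf_le_right hy)⟩
    · rintro ⟨hx, hy⟩ hxy
      rcases hJ.mem_or_mem hxy with h1 | h1
      · exact hx h1
      · exact hy h1
  · intro x y
    rw [Order.Ideal.sup_mem_iff]
    tauto

theorem finset_sup (φ : BPt B) {ι : Type*} (s : Finset ι) (f : ι → B) :
    φ.p (s.sup f) ↔ ∃ i ∈ s, φ.p (f i) := by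
  classical
  induction s using Finset.induction_on with
  | empty => simp [φ.bot]
  | insert a s ha ih => simp [φ.sup, ih]

theorem lub (φ : BPt B) {s : Set B} (hs : s.Finite) {z : B} (hz : IsLUB s z) :
    φ.p z ↔ ∃ x ∈ s, φ.p x := by
  have h1 : z = hs.toFinset.sup id := by
    refine hz.unique ?_
    have := Finset.isLUB_sup_id (s := hs.toFinset)
    simpa using this
  rw [h1, finset_sup]
  simp

end BPt

namespace BoolPow

variable {A C B : Type*} [BooleanAlgebra B]

theorem supp_finite (X : BoolPow A B) : {a | X.1 a ≠ ⊥}.Finite := by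
  refine Set.Finite.of_finite_image (f := X.1) (X.2.1.subset (Set.image_subset_range _ _)) ?_
  intro a ha b hb hab
  by_contra hne
  have := X.2.2.2 a b hne
  rw [← hab, inf_idem] at this
  exact ha this

theorem exists_pt (X : BoolPow A B) (φ : BPt B) : ∃ a, φ.p (X.1 a) := by
  obtain ⟨x, ⟨a, rfl⟩, h⟩ := (φ.lub X.2.1 X.2.2.1).1 φ.top
  exact ⟨a, h⟩

noncomputable def ev (X : BoolPow A B) (φ : BPt B) : A := (X.exists_pt φ).choose

theorem ev_spec (X : BoolPow A B) (φ : BPt B) : φ.p (X.1 (X.ev φ)) := (X.exists_pt φ).choose_spec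

theorem ev_eq (X : BoolPow A B) (φ : BPt B) {a : A} (h : φ.p (X.1 a)) : X.ev φ = a := by
  by_contra hne
  have h2 := X.2.2.2 _ _ hne
  have h3 := (φ.inf _ _).2 ⟨X.ev_spec φ, h⟩
  rw [h2] at h3
  exact φ.bot h3

theorem ev_iff (X : BoolPow A B) (φ : BPt B) (a : A) : φ.p (X.1 a) ↔ X.ev φ = a :=
  ⟨X.ev_eq φ, fun h => h ▸ X.ev_spec φ⟩

theorem ev_mem (X : BoolPow A B) (φ : BPt B) : X.ev φ ∈ X.supp_finite.toFinset := by
  simp only [Set.Finite.mem_toFinset, Set.mem_ofPred_eq]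
  intro h
  have := X.ev_spec φ
  rw [h] at this
  exact φ.bot this

theorem ext_ev {X Y : BoolPow A B} (h : ∀ φ, X.ev φ = Y.ev φ) : X = Y := by
  apply Subtype.ext
  funext a
  apply le_antisymm
  · exact BPt.sep fun φ hφ => (Y.ev_iff φ a).2 (h φ ▸ X.ev_eq φ hφ)
  · exact BPt.sep fun φ hφ => (X.ev_iff φ a).2 ((h φ).trans (Y.ev_eq φ hφ))

theorem ev_op {f : A → A → A} {X Y Z : BoolPow A B} (h : IsBPOp f X.1 Y.1 Z.1) (φ : BPt B) :
    Z.ev φ = f (X.ev φ) (Y.ev φ) := by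
  apply Z.ev_eq
  exact φ.mono ((h _).1 ⟨X.ev φ, Y.ev φ, rfl, rfl⟩)
    ((φ.inf _ _).2 ⟨X.ev_spec φ, Y.ev_spec φ⟩)

theorem ev_const {c : A} {Z : BoolPow A B} (h : IsBPConst c Z.1) (φ : BPt B) :
    Z.ev φ = c := by
  apply Z.ev_eq
  rw [h.1]
  exact φ.top

open Classical in
/-- Pushforward along a map. -/
noncomputable def pushFun (f : A → C) (X : BoolPow A B) (c : C) : B :=
  (X.supp_finite.toFinset.filter (fun a => f a = c)).sup X.1

theorem pushFun_iff (f : A → C) (X : BoolPow A B) (c : C) (φ : BPt B) :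
    φ.p (pushFun f X c) ↔ f (X.ev φ) = c := by
  classical
  unfold pushFun
  rw [BPt.finset_sup]
  constructor
  · rintro ⟨a, ha, h⟩
    rw [X.ev_eq φ h]
    exact (Finset.mem_filter.1 ha).2
  · intro h
    exact ⟨X.ev φ, Finset.mem_filter.2 ⟨X.ev_mem φ, h⟩, X.ev_spec φ⟩

noncomputable def push (f : A → C) (X : BoolPow A B) : BoolPow C B :=
  ⟨pushFun f X, by
    classical
    refine ⟨?_, ?_, ?_⟩
    · refine (((X.supp_finite.image f).image (pushFun f X)).union (Set.finite_singleton ⊥)).subset ?_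
      rintro _ ⟨c, rfl⟩
      by_cases hc : c ∈ f '' {a | X.1 a ≠ ⊥}
      · exact Or.inl ⟨c, hc, rfl⟩
      · right
        have : pushFun f X c ≤ ⊥ := BPt.sep fun φ hφ => by
          rw [pushFun_iff] at hφ
          exact absurd ⟨X.ev φ, by simpa using X.ev_mem φ, hφ⟩ hc
        exact le_bot_iff.1 this
    · refine ⟨fun _ _ => le_top, fun z hz => BPt.sep fun φ _ => ?_⟩
      exact φ.mono (hz ⟨f (X.ev φ), rfl⟩) ((pushFun_iff f X _ φ).2 rfl)
    · intro a b hab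
      refine le_bot_iff.1 (BPt.sep fun φ hφ => ?_)
      rw [φ.inf, pushFun_iff, pushFun_iff] at hφ
      exact absurd (hφ.1.symm.trans hφ.2) hab⟩

theorem ev_push (f : A → C) (X : BoolPow A B) (φ : BPt B) : (push f X).ev φ = f (X.ev φ) :=
  ev_eq _ φ ((pushFun_iff f X _ φ).2 rfl)

end BoolPow

theorem rl_mul_le_right {A : Type*} [ResiduatedLattice A] (a b : A) : mul a b ≤ b := by
  rw [← residuation]
  refine le_trans le_top ?_
  rw [residuation, ResiduatedLattice.mul_comm, mul_top]

theorem rl_rpow_anti {A : Type*} [ResiduatedLattice A] (a : A) : Antitone (rpow a) :=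
  antitone_nat_of_succ_le fun _ => rl_mul_le_right _ _

/-- the reticulation functor preserves Boolean powers: if `A` is a
residuated lattice, `B` a Boolean algebra, `(LA, lam)` a reticulation of `A`,
`A[B]` the Boolean-power residuated lattice (its operations being the ones induced
by those of `A`), `LA[B]` the Boolean-power bounded distributive lattice (its
operations being the ones induced by those of `LA`), and `(LP, lamP)` a reticulation
of `A[B]`, then `LP` is isomorphic to `LA[B]` as bounded distributive lattices. -/
theorem stmt_7 {A B LA : Type*} [ResiduatedLattice A] [BooleanAlgebra B]
    [DistribLattice LA] [BoundedOrder LA]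
    (lam : A → LA) (hlam : IsReticulation lam)
    -- the residuated lattice structure on the Boolean power `A[B]`
    [instP : ResiduatedLattice (BoolPow A B)]
    (hPsup : ∀ X Y : BoolPow A B, IsBPOp (fun x y : A => x ⊔ y) X.1 Y.1 (X ⊔ Y).1)
    (hPinf : ∀ X Y : BoolPow A B, IsBPOp (fun x y : A => x ⊓ y) X.1 Y.1 (X ⊓ Y).1)
    (hPmul : ∀ X Y : BoolPow A B, IsBPOp (mul : A → A → A) X.1 Y.1 (mul X Y).1)
    (hPhimp : ∀ X Y : BoolPow A B, IsBPOp (himp : A → A → A) X.1 Y.1 (himp X Y).1)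
    (hPbot : IsBPConst (⊥ : A) (⊥ : BoolPow A B).1)
    (hPtop : IsBPConst (⊤ : A) (⊤ : BoolPow A B).1)
    -- the bounded distributive lattice structure on the Boolean power `LA[B]`
    [instD : DistribLattice (BoolPow LA B)] [instB : BoundedOrder (BoolPow LA B)]
    (hLsup : ∀ X Y : BoolPow LA B, IsBPOp (fun x y : LA => x ⊔ y) X.1 Y.1 (X ⊔ Y).1)
    (hLinf : ∀ X Y : BoolPow LA B, IsBPOp (fun x y : LA => x ⊓ y) X.1 Y.1 (X ⊓ Y).1)
    (hLbot : IsBPConst (⊥ : LA) (⊥ : BoolPow LA B).1)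
    (hLtop : IsBPConst (⊤ : LA) (⊤ : BoolPow LA B).1)
    -- a reticulation of `A[B]`
    {LP : Type*} [DistribLattice LP] [BoundedOrder LP]
    (lamP : BoolPow A B → LP) (hlamP : IsReticulation lamP) :
    ∃ e : LP ≃ BoolPow LA B,
      (∀ x y : LP, e (x ⊓ y) = e x ⊓ e y) ∧
      (∀ x y : LP, e (x ⊔ y) = e x ⊔ e y) ∧
      e ⊥ = ⊥ ∧ e ⊤ = ⊤ := by
  classical
  have hpow : ∀ (X : BoolPow A B) (φ : BPt B) (n : ℕ),
      (rpow X n).ev φ = rpow (X.ev φ) n := by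
    intro X φ n
    induction n with
    | zero => exact BoolPow.ev_const hPtop φ
    | succ n ih =>
      have := BoolPow.ev_op (hPmul X (rpow X n)) φ
      rw [ih] at this
      exact this
  have hPle : ∀ X Y : BoolPow A B, X ≤ Y ↔ ∀ φ, X.ev φ ≤ Y.ev φ := by
    intro X Y
    rw [← inf_eq_left]
    constructor
    · intro h φ
      have := BoolPow.ev_op (hPinf X Y) φ
      rw [h] at this
      exact inf_eq_left.1 this.symm
    · intro h
      refine BoolPow.ext_ev fun φ => ?_
      rw [BoolPow.ev_op (hPinf X Y) φ]
      exact inf_eq_left.2 (h φ)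
  have hLle : ∀ X Y : BoolPow LA B, X ≤ Y ↔ ∀ φ, X.ev φ ≤ Y.ev φ := by
    intro X Y
    rw [← inf_eq_left]
    constructor
    · intro h φ
      have := BoolPow.ev_op (hLinf X Y) φ
      rw [h] at this
      exact inf_eq_left.1 this.symm
    · intro h
      refine BoolPow.ext_ev fun φ => ?_
      rw [BoolPow.ev_op (hLinf X Y) φ]
      exact inf_eq_left.2 (h φ)
  let M : BoolPow A B → BoolPow LA B := BoolPow.push lam
  have hM : ∀ X φ, (M X).ev φ = lam (X.ev φ) := BoolPow.ev_push lam
  have hMmul : ∀ X Y, M (mul X Y) = M X ⊓ M Y := fun X Y => BoolPow.ext_ev fun φ => by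
    rw [BoolPow.ev_op (hLinf _ _) φ, hM, hM, hM, BoolPow.ev_op (hPmul _ _) φ, hlam.map_mul]
  have hMsup : ∀ X Y, M (X ⊔ Y) = M X ⊔ M Y := fun X Y => BoolPow.ext_ev fun φ => by
    rw [BoolPow.ev_op (hLsup _ _) φ, hM, hM, hM, BoolPow.ev_op (hPsup _ _) φ, hlam.map_sup]
  have hMbot : M ⊥ = ⊥ := BoolPow.ext_ev fun φ => by
    rw [hM, BoolPow.ev_const hPbot, BoolPow.ev_const hLbot, hlam.map_bot]
  have hMtop : M ⊤ = ⊤ := BoolPow.ext_ev fun φ => by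
    rw [hM, BoolPow.ev_const hPtop, BoolPow.ev_const hLtop, hlam.map_top]
  have hMsurj : Function.Surjective M := fun Z =>
    ⟨BoolPow.push (Function.surjInv hlam.surj) Z, BoolPow.ext_ev fun φ => by
      rw [hM, BoolPow.ev_push, Function.surjInv_eq hlam.surj]⟩
  have hMle : ∀ X Y, M X ≤ M Y ↔ lamP X ≤ lamP Y := by
    intro X Y
    rw [hlamP.le_iff, hLle]
    simp only [hM, hlam.le_iff, hPle, hpow]
    constructor
    · intro h
      let N : A × A → ℕ := fun q =>
        if hq : ∃ n : ℕ, 1 ≤ n ∧ rpow q.1 n ≤ q.2 then hq.choose else 0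
      let S := X.supp_finite.toFinset ×ˢ Y.supp_finite.toFinset
      refine ⟨S.sup N + 1, by omega, fun φ => ?_⟩
      have hmem : (X.ev φ, Y.ev φ) ∈ S := Finset.mem_product.2 ⟨X.ev_mem φ, Y.ev_mem φ⟩
      have hN : N (X.ev φ, Y.ev φ) = (h φ).choose := dif_pos (h φ)
      have h1 := Finset.le_sup (f := N) hmem
      rw [hN] at h1
      exact (rl_rpow_anti _ (by omega)).trans (h φ).choose_spec.2
    · rintro ⟨n, hn, h⟩ φ
      exact ⟨n, hn, h φ⟩
  have hMeq : ∀ X Y, M X = M Y ↔ lamP X = lamP Y := fun X Y => by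
    rw [le_antisymm_iff, le_antisymm_iff, hMle, hMle]
  let s := Function.surjInv hlamP.surj
  have hs : ∀ x, lamP (s x) = x := Function.surjInv_eq hlamP.surj
  have he : ∀ X, M (s (lamP X)) = M X := fun X => (hMeq _ _).2 (hs _)
  have hbij : Function.Bijective (fun x => M (s x)) := by
    refine ⟨?_, ?_⟩
    · intro x y hxy
      rw [← hs x, ← hs y]
      exact (hMeq _ _).1 hxy
    · intro Z
      obtain ⟨X, rfl⟩ := hMsurj Z
      exact ⟨lamP X, he X⟩
  have hee : ∀ X, Equiv.ofBijective _ hbij (lamP X) = M X := he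
  refine ⟨Equiv.ofBijective _ hbij, ?_, ?_, ?_, ?_⟩
  · intro x y
    obtain ⟨X, rfl⟩ := hlamP.surj x
    obtain ⟨Y, rfl⟩ := hlamP.surj y
    rw [← hlamP.map_mul, hee, hee, hee, hMmul]
  · intro x y
    obtain ⟨X, rfl⟩ := hlamP.surj x
    obtain ⟨Y, rfl⟩ := hlamP.surj y
    rw [← hlamP.map_sup, hee, hee, hee, hMsup]
  · rw [← hlamP.map_bot, hee, hMbot]
  · rw [← hlamP.map_top, hee, hMtop]
end

section
/- Let A be a residuated lattice and (L, λ) a reticulation of A. For any subset X of A, λ(X^⊤) = (λ(X))^⊤, i.e., the image under λ of the co-annihilator of X equals the co-annihilator in L of the image λ(X). -/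
open ResiduatedLattice

/-- for a reticulation `(L, lam)` of a residuated lattice `A` and any
subset `X ⊆ A`, `lam '' (X^⊤) = (lam '' X)^⊤`. -/
theorem stmt_9 {A L : Type*} [ResiduatedLattice A] [DistribLattice L] [BoundedOrder L]
    (lam : A → L) (h : IsReticulation lam) (X : Set A) :
    lam '' coann X = coann (lam '' X) := by
  have hp : ∀ n : ℕ, rpow (⊤ : A) n = ⊤ := by
    intro n
    induction n with
    | zero => rfl
    | succ k ih =>
      show mul ⊤ (rpow (⊤ : A) k) = ⊤
      rw [ih, ResiduatedLattice.mul_top]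
  have ht : ∀ a : A, lam a = ⊤ → a = ⊤ := by
    intro a ha
    obtain ⟨n, _, hn⟩ := (h.le_iff ⊤ a).1 (by rw [ha]; exact le_top)
    rw [hp] at hn
    exact top_le_iff.1 hn
  ext l
  constructor
  · rintro ⟨a, ha, rfl⟩ _ ⟨x, hx, rfl⟩
    rw [← h.map_sup, ha x hx, h.map_top]
  · intro hl
    obtain ⟨a, rfl⟩ := h.surj l
    refine ⟨a, fun x hx => ht _ ?_, rfl⟩
    rw [h.map_sup]
    exact hl _ ⟨x, hx, rfl⟩
end

section
/- Let A be a residuated lattice and (L, λ) a reticulation of A. Then A is a Stone residuated lattice if and only if L is a Stone lattice. -/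
open ResiduatedLattice

/-- A Stone residuated lattice: every co-annihilator `a^⊤` is a principal filter
generated by a complemented element. -/
def IsStoneRL (A : Type*) [ResiduatedLattice A] : Prop :=
  ∀ a : A, ∃ e ∈ BCenter A, coann {a} = rprinc e

/-- A Stone bounded distributive lattice: every co-annihilator `l^⊤` is a principal
filter generated by a complemented element. -/
def IsStoneLat (L : Type*) [Lattice L] [BoundedOrder L] : Prop :=
  ∀ l : L, ∃ e ∈ BCenter L, coann {l} = Set.Ici e

namespace ResiduatedLattice

theorem aux_mono {A : Type*} [ResiduatedLattice A] {a b : A} (c : A) (h : a ≤ b) :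
    mul a c ≤ mul b c :=
  (residuation a c _).1 (h.trans ((residuation b c _).2 le_rfl))

theorem aux_mul_le_left {A : Type*} [ResiduatedLattice A] (a b : A) : mul a b ≤ a := by
  have := aux_mono a (le_top (a := b))
  rwa [mul_comm, mul_comm ⊤, mul_top] at this

theorem aux_mul_le_right {A : Type*} [ResiduatedLattice A] (a b : A) : mul a b ≤ b := by
  rw [mul_comm]; exact aux_mul_le_left b a

theorem aux_rpow_top {A : Type*} [ResiduatedLattice A] (n : ℕ) : rpow (⊤ : A) n = ⊤ := by
  induction n with
  | zero => rfl
  | succ n ih => rw [rpow, ih, mul_top]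

theorem aux_rpow_mul {A : Type*} [ResiduatedLattice A] (a b : A) (n : ℕ) :
    rpow (mul a b) n = mul (rpow a n) (rpow b n) := by
  induction n with
  | zero => simp only [rpow, mul_top]
  | succ n ih =>
    simp only [rpow, ih]
    rw [mul_assoc, mul_assoc, ← mul_assoc b, mul_comm b, mul_assoc (rpow a n)]

theorem aux_inf {A : Type*} [ResiduatedLattice A] (a b : A) (h1 : mul a b = ⊥)
    (h2 : a ⊔ b = ⊤) : a ⊓ b = ⊥ := by
  have ha : a ≤ himp (a ⊓ b) ⊥ := by
    rw [residuation, mul_comm, ← h1, mul_comm a b]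
    exact aux_mono _ inf_le_right
  have hb : b ≤ himp (a ⊓ b) ⊥ := by
    rw [residuation, mul_comm, ← h1]
    exact aux_mono _ inf_le_left
  have h3 := sup_le ha hb
  rw [h2, residuation, mul_comm, mul_top] at h3
  exact le_bot_iff.1 h3

end ResiduatedLattice

theorem aux_lam_top {A L : Type*} [ResiduatedLattice A] [DistribLattice L] [BoundedOrder L]
    {lam : A → L} (h : IsReticulation lam) (a : A) : lam a = ⊤ ↔ a = ⊤ := by
  constructor
  · intro ha
    obtain ⟨n, _, hn⟩ := (h.le_iff ⊤ a).1 (by rw [ha]; exact le_top)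
    rw [aux_rpow_top] at hn
    exact top_le_iff.1 hn
  · rintro rfl
    exact h.map_top

theorem aux_lam_rpow {A L : Type*} [ResiduatedLattice A] [DistribLattice L] [BoundedOrder L]
    {lam : A → L} (h : IsReticulation lam) (a : A) (n : ℕ) : lam (rpow a (n + 1)) = lam a := by
  induction n with
  | zero => simp only [rpow, ResiduatedLattice.mul_top]
  | succ n ih => rw [rpow, h.map_mul, ih, inf_idem]

theorem aux_coann {A L : Type*} [ResiduatedLattice A] [DistribLattice L] [BoundedOrder L]
    {lam : A → L} (h : IsReticulation lam) (a e : A) :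
    coann {a} = rprinc e ↔ coann {lam a} = Set.Ici (lam e) := by
  have h1 : ∀ b, b ∈ coann {a} ↔ lam b ∈ coann {lam a} := by
    intro b
    simp only [coann, Set.mem_setOf_eq, Set.mem_singleton_iff, forall_eq]
    rw [← h.map_sup, aux_lam_top h]
  have h2 : ∀ b, b ∈ rprinc e ↔ lam b ∈ Set.Ici (lam e) := fun b => (h.le_iff e b).symm
  rw [Set.ext_iff, Set.ext_iff, h.surj.forall]
  simp only [h1, h2]

/-- `A` is a Stone residuated lattice iff its reticulation `L` is a
Stone lattice. -/
theorem stmt_10 {A L : Type*} [ResiduatedLattice A] [DistribLattice L] [BoundedOrder L]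
    (lam : A → L) (h : IsReticulation lam) :
    IsStoneRL A ↔ IsStoneLat L := by
  constructor
  · intro hA
    refine h.surj.forall.2 fun a => ?_
    obtain ⟨e, ⟨f, hf1, hf2⟩, he⟩ := hA a
    refine ⟨lam e, ⟨lam f, ?_, ?_⟩, (aux_coann h a e).1 he⟩
    · have : mul e f = ⊥ := by
        rw [← le_bot_iff, ← hf1]
        exact le_inf (aux_mul_le_left e f) (aux_mul_le_right e f)
      rw [← h.map_mul, this, h.map_bot]
    · rw [← h.map_sup, hf2, h.map_top]
  · intro hL a
    obtain ⟨e', ⟨f', hf1, hf2⟩, he⟩ := hL (lam a)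
    obtain ⟨e, rfl⟩ := h.surj e'
    obtain ⟨f, rfl⟩ := h.surj f'
    obtain ⟨n, hn, hn'⟩ := (h.le_iff (mul e f) ⊥).1 (by rw [h.map_mul, hf1, h.map_bot])
    obtain ⟨m, rfl⟩ : ∃ m, n = m + 1 := ⟨n - 1, by omega⟩
    rw [aux_rpow_mul, le_bot_iff] at hn'
    have hs : rpow e (m + 1) ⊔ rpow f (m + 1) = ⊤ := by
      rw [← aux_lam_top h, h.map_sup, aux_lam_rpow h, aux_lam_rpow h, hf2]
    refine ⟨rpow e (m + 1), ⟨rpow f (m + 1), aux_inf _ _ hn' hs, hs⟩, ?_⟩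
    rw [aux_coann h, aux_lam_rpow h]
    exact he
end

section
/- Let A be a residuated lattice and m an infinite cardinal. Then the following are equivalent: (i) for each subset X of A with |X| ≤ m there exists e ∈ B(A) such that X^⊤ = <e>; (ii) A is a Stone residuated lattice and B(A) is an m-complete Boolean algebra. -/
open ResiduatedLattice

section helpers

variable {A : Type*} [ResiduatedLattice A]

theorem hh_mul_mono {a b c : A} (h : b ≤ c) : mul b a ≤ mul c a :=
  (residuation b a _).1 (h.trans ((residuation c a _).2 le_rfl))

theorem hh_mul_le_right (a b : A) : mul a b ≤ b := by
  have h : mul a b ≤ mul ⊤ b := hh_mul_mono le_top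
  rwa [ResiduatedLattice.mul_comm ⊤ b, mul_top] at h

theorem hh_mul_le_left (a b : A) : mul a b ≤ a := by
  rw [ResiduatedLattice.mul_comm]; exact hh_mul_le_right b a

/-- residuated form of Boolean complementation -/
theorem hh_le_mul {e f b : A} (h : e ⊓ f = ⊥) (hb : f ⊔ b = ⊤) : e ≤ mul e b := by
  have h1 : f ≤ himp e (mul e b) := by
    rw [residuation]
    have : mul f e ≤ e ⊓ f := le_inf (hh_mul_le_right _ _) (hh_mul_le_left _ _)
    rw [h] at this
    exact this.trans bot_le
  have h2 : b ≤ himp e (mul e b) := by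
    rw [residuation, ResiduatedLattice.mul_comm]
  have h3 : (⊤ : A) ≤ himp e (mul e b) := hb ▸ sup_le h1 h2
  rw [residuation, ResiduatedLattice.mul_comm, mul_top] at h3
  exact h3

theorem hh_iff {e f : A} (h : e ⊓ f = ⊥) (h' : e ⊔ f = ⊤) (b : A) :
    f ⊔ b = ⊤ ↔ e ≤ b := by
  constructor
  · intro hb
    exact (hh_le_mul h hb).trans (hh_mul_le_right _ _)
  · intro hb
    rw [eq_top_iff, ← h']
    exact sup_le (hb.trans le_sup_right) le_sup_left

theorem hh_princ {e : A} (he : e ∈ BCenter A) (b : A) : b ∈ rprinc e ↔ e ≤ b := by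
  obtain ⟨f, h, h'⟩ := he
  have hee : e ≤ mul e e := hh_le_mul h (by rw [sup_comm]; exact h')
  have hp : ∀ n, e ≤ rpow e n := by
    intro n
    induction n with
    | zero => exact le_top
    | succ k ih =>
      refine hee.trans ?_
      change mul e e ≤ mul e (rpow e k)
      rw [ResiduatedLattice.mul_comm e (rpow e k)]
      exact hh_mul_mono ih
  constructor
  · rintro ⟨n, _, hn⟩
    exact (hp n).trans hn
  · intro hb
    refine ⟨1, le_rfl, ?_⟩
    change mul e ⊤ ≤ b
    rwa [mul_top]

end helpers

/-- for a residuated lattice `A` and an infinite cardinal `m`, the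
following are equivalent: (i) for each `X ⊆ A` with `|X| ≤ m` there is a complemented
element `e` with `X^⊤ = <e>`; (ii) `A` is a Stone residuated lattice and the Boolean
algebra `B(A)` of complemented elements is `m`-complete (every subset of `B(A)` of
cardinality at most `m` has an infimum and a supremum in `B(A)`). -/
theorem stmt_13 {A : Type*} [ResiduatedLattice A] (m : Cardinal) (hm : Cardinal.aleph0 ≤ m) :
    (∀ X : Set A, Cardinal.mk X ≤ m → ∃ e ∈ BCenter A, coann X = rprinc e) ↔
    ((∀ a : A, ∃ e ∈ BCenter A, coann {a} = rprinc e) ∧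
      (∀ S : Set A, S ⊆ BCenter A → Cardinal.mk S ≤ m →
        (∃ e, IsLeast {u ∈ BCenter A | ∀ s ∈ S, s ≤ u} e) ∧
        (∃ e, IsGreatest {u ∈ BCenter A | ∀ s ∈ S, u ≤ s} e))) := by
  classical
  constructor
  · intro H
    refine ⟨fun a => H {a} ?_, fun S hS hc => ⟨?_, ?_⟩⟩
    · rw [Cardinal.mk_singleton]
      exact Cardinal.one_le_aleph0.trans hm
    · choose! c hc1 hc2 using hS
      obtain ⟨e, he, heq⟩ := H (c '' S) (Cardinal.mk_image_le.trans hc)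
      have key : ∀ b, e ≤ b ↔ ∀ s ∈ S, s ≤ b := by
        intro b
        rw [← hh_princ he, ← heq]
        constructor
        · intro hb s hs
          rw [← hh_iff (hc1 hs) (hc2 hs), sup_comm]
          exact hb _ ⟨s, hs, rfl⟩
        · rintro hb _ ⟨s, hs, rfl⟩
          rw [sup_comm, hh_iff (hc1 hs) (hc2 hs)]
          exact hb s hs
      exact ⟨e, ⟨he, (key e).1 le_rfl⟩, fun u hu => (key u).2 hu.2⟩
    · obtain ⟨e, he, heq⟩ := H S hc
      obtain ⟨f, h1, h2⟩ := id he
      have h1' : f ⊓ e = ⊥ := by rw [inf_comm]; exact h1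
      have h2' : f ⊔ e = ⊤ := by rw [sup_comm]; exact h2
      refine ⟨f, ⟨⟨e, h1', h2'⟩, ?_⟩, ?_⟩
      · intro s hs
        rw [← hh_iff h1' h2']
        have : e ∈ coann S := by rw [heq, hh_princ he]
        exact this s hs
      · rintro u ⟨⟨v, k1, k2⟩, hu⟩
        have : v ∈ coann S := fun s hs => (hh_iff k1 k2 s).2 (hu s hs)
        rw [heq, hh_princ he] at this
        rw [← hh_iff k1 k2, eq_top_iff, ← h2]
        exact sup_le_sup_right this f
  · rintro ⟨H, K⟩ X hX
    choose g hg hgeq using H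
    have hgi : ∀ x b, b ⊔ x = ⊤ ↔ g x ≤ b := by
      intro x b
      rw [← hh_princ (hg x), ← hgeq]
      simp [coann]
    obtain ⟨⟨e, ⟨he, hub⟩, hl⟩, -⟩ := K (g '' X)
      (by rintro _ ⟨x, _, rfl⟩; exact hg x) (Cardinal.mk_image_le.trans hX)
    refine ⟨e, he, ?_⟩
    ext b
    rw [hh_princ he]
    constructor
    · intro hb
      obtain ⟨f, h1, h2⟩ := hg b
      have h1' : f ⊓ g b = ⊥ := by rw [inf_comm]; exact h1
      have h2' : f ⊔ g b = ⊤ := by rw [sup_comm]; exact h2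
      have hfb : f ≤ b := (hh_iff h1' h2' b).1 ((hgi b _).2 le_rfl)
      refine le_trans (hl ⟨⟨g b, h1', h2'⟩, ?_⟩) hfb
      rintro _ ⟨x, hx, rfl⟩
      rw [← hgi, hh_iff h1 h2, ← hgi, sup_comm]
      exact hb x hx
    · intro hb x hx
      rw [hgi]
      exact (hub _ ⟨x, hx, rfl⟩).trans hb
end

section
/- Let A be a residuated lattice and m an infinite cardinal. Then the following are equivalent: (i) for each subset X of A with |X| ≤ m there exists e ∈ B(A) such that X^⊤ = <e>; (v) for each subset X of A with |X| ≤ m, X^⊤ ∨ X^⊤⊤ = A, where ∨ denotes the join in the lattice of filters of A (the filter generated by the union). -/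
open ResiduatedLattice

/-- The filter of a residuated lattice generated by a subset `S`: the intersection of
all filters containing `S`. -/
def rlFilterGen {A : Type*} [ResiduatedLattice A] (S : Set A) : Set A :=
  ⋂₀ {F : Set A | IsRLFilter F ∧ S ⊆ F}

namespace RLAux

variable {A : Type*} [ResiduatedLattice A]

theorem mul_mono_left {a b : A} (c : A) (h : a ≤ b) : mul a c ≤ mul b c :=
  (residuation a c _).1 (h.trans ((residuation b c _).2 le_rfl))

theorem mul_mono {a b c d : A} (h : a ≤ b) (h' : c ≤ d) : mul a c ≤ mul b d := by
  refine (mul_mono_left c h).trans ?_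
  rw [ResiduatedLattice.mul_comm b c, ResiduatedLattice.mul_comm b d]
  exact mul_mono_left b h'

theorem mul_le_left (a b : A) : mul a b ≤ a := by
  have h := mul_mono (le_refl a) (le_top (a := b))
  rwa [ResiduatedLattice.mul_top] at h

theorem mul_le_right (a b : A) : mul a b ≤ b := by
  rw [ResiduatedLattice.mul_comm]; exact mul_le_left b a

theorem sup_mul_le {a b c d : A} (h1 : mul a c ≤ d) (h2 : mul b c ≤ d) : mul (a ⊔ b) c ≤ d :=
  (residuation _ _ _).1 (sup_le ((residuation _ _ _).2 h1) ((residuation _ _ _).2 h2))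

theorem coann_filter (X : Set A) : IsRLFilter (coann X) := by
  refine ⟨⟨⊤, fun x _ => top_sup_eq x⟩, ?_, ?_⟩
  · intro a ha b hb x hx
    have h1 := ha x hx
    have h2 := hb x hx
    have h : mul (a ⊔ x) (b ⊔ x) ≤ mul a b ⊔ x := by
      apply sup_mul_le
      · rw [ResiduatedLattice.mul_comm]
        apply sup_mul_le
        · rw [ResiduatedLattice.mul_comm]; exact le_sup_left
        · exact (mul_le_left _ _).trans le_sup_right
      · exact (mul_le_left _ _).trans le_sup_right
    rw [h1, h2, ResiduatedLattice.mul_top] at h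
    exact top_le_iff.1 h
  · intro a ha b hab x hx
    have h1 := ha x hx
    exact top_le_iff.1 (h1 ▸ sup_le_sup_right hab x)

theorem top_mem {F : Set A} (hF : IsRLFilter F) : (⊤ : A) ∈ F := by
  obtain ⟨⟨a, ha⟩, _, h⟩ := hF
  exact h a ha _ le_top

theorem rprinc_sub {F : Set A} (hF : IsRLFilter F) {a : A} (ha : a ∈ F) : rprinc a ⊆ F := by
  rintro b ⟨n, -, hb⟩
  refine hF.2.2 _ ?_ b hb
  clear hb
  induction n with
  | zero => exact top_mem hF
  | succ k ih => exact hF.2.1 a ha _ ih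

theorem rpow_one (a : A) : rpow a 1 = a := ResiduatedLattice.mul_top a

theorem mul_mul_comm4 (a b c d : A) :
    mul (mul a b) (mul c d) = mul (mul a c) (mul b d) := by
  rw [ResiduatedLattice.mul_assoc, ResiduatedLattice.mul_assoc,
    ← ResiduatedLattice.mul_assoc b c d, ResiduatedLattice.mul_comm b c,
    ResiduatedLattice.mul_assoc c b d]

theorem join_filter {F G : Set A} (hF : IsRLFilter F) (hG : IsRLFilter G) :
    IsRLFilter {c : A | ∃ a ∈ F, ∃ b ∈ G, mul a b ≤ c} := by
  refine ⟨⟨⊤, ⊤, top_mem hF, ⊤, top_mem hG, le_top⟩, ?_, ?_⟩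
  · rintro c ⟨a, ha, b, hb, h⟩ c' ⟨a', ha', b', hb', h'⟩
    refine ⟨mul a a', hF.2.1 a ha a' ha', mul b b', hG.2.1 b hb b' hb', ?_⟩
    rw [mul_mul_comm4]
    exact mul_mono h h'
  · rintro c ⟨a, ha, b, hb, h⟩ d hd
    exact ⟨a, ha, b, hb, h.trans hd⟩

end RLAux

open RLAux

/-- for a residuated lattice `A` and an infinite cardinal `m`, the
following are equivalent: (i) for each `X ⊆ A` with `|X| ≤ m` there is a complemented
element `e` with `X^⊤ = <e>`; (v) for each `X ⊆ A` with `|X| ≤ m`,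
`X^⊤ ∨ X^⊤⊤ = A`, the join being taken in the lattice of filters of `A`. -/
theorem stmt_14 {A : Type*} [ResiduatedLattice A] (m : Cardinal) (hm : Cardinal.aleph0 ≤ m) :
    (∀ X : Set A, Cardinal.mk X ≤ m → ∃ e ∈ BCenter A, coann X = rprinc e) ↔
    (∀ X : Set A, Cardinal.mk X ≤ m →
      rlFilterGen (coann X ∪ coann (coann X)) = Set.univ) := by
  constructor
  · intro H X hX
    obtain ⟨e, ⟨f, hinf, hsup⟩, he⟩ := H X hX
    have heX : e ∈ coann X := by
      rw [he]; exact ⟨1, le_rfl, (rpow_one e).le⟩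
    have hfX : f ∈ coann (coann X) := by
      intro b hb
      rw [he] at hb
      have hef : e ∈ coann ({f} : Set A) := by
        intro x hx
        rw [Set.mem_singleton_iff.1 hx]; exact hsup
      have := rprinc_sub (coann_filter _) hef hb f rfl
      rwa [sup_comm]
    refine Set.eq_univ_of_forall fun c => ?_
    rintro F ⟨hF, hs⟩
    refine hF.2.2 _ (hF.2.1 e (hs (Or.inl heX)) f (hs (Or.inr hfX))) c ?_
    exact (le_inf (mul_le_left e f) (mul_le_right e f)).trans (hinf.le.trans bot_le)
  · intro H X hX
    have h0 : (⊥ : A) ∈ rlFilterGen (coann X ∪ coann (coann X)) := by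
      rw [H X hX]; trivial
    obtain ⟨a, ha, b, hb, hab⟩ := h0 _ ⟨join_filter (coann_filter X) (coann_filter (coann X)), by
      rintro c (hc | hc)
      · exact ⟨c, hc, ⊤, top_mem (coann_filter _), mul_le_left _ _⟩
      · exact ⟨⊤, top_mem (coann_filter _), c, hc, mul_le_right _ _⟩⟩
    have hs : b ⊔ a = ⊤ := hb a ha
    refine ⟨a, ⟨b, ?_, by rw [sup_comm]; exact hs⟩, ?_⟩
    · have h : mul (b ⊔ a) (a ⊓ b) ≤ ⊥ := by
        apply sup_mul_le
        · rw [ResiduatedLattice.mul_comm]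
          exact (mul_mono inf_le_left le_rfl).trans hab
        · exact (mul_mono le_rfl inf_le_right).trans hab
      rw [hs, ResiduatedLattice.mul_comm, ResiduatedLattice.mul_top] at h
      exact le_bot_iff.1 h
    · apply Set.Subset.antisymm
      · intro c hc
        refine ⟨1, le_rfl, ?_⟩
        rw [rpow_one]
        have h : mul (b ⊔ c) a ≤ c := by
          apply sup_mul_le
          · rw [ResiduatedLattice.mul_comm]; exact hab.trans bot_le
          · exact mul_le_left _ _
        rwa [hb c hc, ResiduatedLattice.mul_comm, ResiduatedLattice.mul_top] at h
      · exact rprinc_sub (coann_filter X) ha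
end

section
/- Let A be a residuated lattice, (L, λ) a reticulation of A, and m an infinite cardinal. Then A satisfies: for each subset X of A with |X| ≤ m there exists e ∈ B(A) with X^⊤ = <e> (i.e., A is m-Stone), if and only if L satisfies: for each subset Y of L with |Y| ≤ m there exists f ∈ B(L) with Y^⊤ = <f> (i.e., L is an m-Stone lattice). -/
open ResiduatedLattice

theorem rl_mul_mono {A : Type*} [ResiduatedLattice A] {a b c : A} (hab : a ≤ b) :
    mul a c ≤ mul b c :=
  (residuation a c _).1 (hab.trans ((residuation b c _).2 le_rfl))

theorem rl_mul_le_left {A : Type*} [ResiduatedLattice A] (a b : A) : mul a b ≤ a := by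
  have h1 : mul b a ≤ mul ⊤ a := rl_mul_mono le_top
  rwa [ResiduatedLattice.mul_comm ⊤ a, mul_top, ResiduatedLattice.mul_comm b a] at h1

theorem rl_rpow_top {A : Type*} [ResiduatedLattice A] (n : ℕ) : rpow (⊤ : A) n = ⊤ := by
  induction n with
  | zero => rfl
  | succ n ih => rw [rpow, ih, mul_top]

theorem rl_rpow_mul {A : Type*} [ResiduatedLattice A] (a b : A) (n : ℕ) :
    rpow (mul a b) n = mul (rpow a n) (rpow b n) := by
  induction n with
  | zero => simp [rpow, mul_top]
  | succ n ih =>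
    rw [rpow, rpow, rpow, ih, ResiduatedLattice.mul_assoc, ResiduatedLattice.mul_assoc,
      ← ResiduatedLattice.mul_assoc b, ResiduatedLattice.mul_comm b (rpow a n),
      ResiduatedLattice.mul_assoc]

theorem rl_compl {A : Type*} [ResiduatedLattice A] {c d : A} (hs : c ⊔ d = ⊤)
    (hm : mul c d = ⊥) : c ⊓ d = ⊥ := by
  have h1 : c ⊔ d ≤ himp (c ⊓ d) ⊥ := by
    apply sup_le
    · rw [residuation, ← hm, ResiduatedLattice.mul_comm, ResiduatedLattice.mul_comm c]
      exact rl_mul_mono inf_le_right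
    · rw [residuation, ← hm, ResiduatedLattice.mul_comm]
      exact rl_mul_mono inf_le_left
  rw [hs, residuation, ResiduatedLattice.mul_comm, mul_top] at h1
  exact le_bot_iff.1 h1

section
variable {A L : Type*} [ResiduatedLattice A] [DistribLattice L] [BoundedOrder L]
  {lam : A → L}

theorem ret_top (h : IsReticulation lam) (a : A) : lam a = ⊤ ↔ a = ⊤ := by
  constructor
  · intro ha
    have h1 : lam ⊤ ≤ lam a := by rw [ha]; exact le_top
    obtain ⟨n, -, hn⟩ := (h.le_iff _ _).1 h1
    rw [rl_rpow_top] at hn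
    exact top_le_iff.1 hn
  · rintro rfl; exact h.map_top

theorem ret_pow (h : IsReticulation lam) (a : A) (n : ℕ) : lam (rpow a (n+1)) = lam a := by
  induction n with
  | zero => simp [rpow, mul_top]
  | succ n ih => rw [rpow, h.map_mul, ih, inf_idem]

theorem ret_coann (h : IsReticulation lam) (X : Set A) (a : A) :
    a ∈ coann X ↔ lam a ∈ coann (lam '' X) := by
  simp only [coann, Set.mem_setOf_eq, Set.forall_mem_image, ← h.map_sup, ret_top h]

theorem ret_center (h : IsReticulation lam) {e : A} (he : e ∈ BCenter A) :
    lam e ∈ BCenter L := by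
  obtain ⟨f, h1, h2⟩ := he
  refine ⟨lam f, ?_, ?_⟩
  · rw [← h.map_mul, ← h.map_bot]
    congr 1
    exact le_bot_iff.1 (h1 ▸ le_inf (rl_mul_le_left e f) (rl_mul_le_right e f))
  · rw [← h.map_sup, h2, h.map_top]

theorem ret_lift (h : IsReticulation lam) {f : L} (hf : f ∈ BCenter L) :
    ∃ e ∈ BCenter A, lam e = f := by
  obtain ⟨g, h1, h2⟩ := hf
  obtain ⟨a, rfl⟩ := h.surj f
  obtain ⟨b, rfl⟩ := h.surj g
  have h3 : lam (mul a b) ≤ lam ⊥ := by rw [h.map_mul, h1]; exact bot_le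
  obtain ⟨n, hn, h4⟩ := (h.le_iff _ _).1 h3
  obtain ⟨k, rfl⟩ := Nat.exists_eq_add_of_le' hn
  rw [rl_rpow_mul] at h4
  have h5 : rpow a (k+1) ⊔ rpow b (k+1) = ⊤ := by
    rw [← ret_top h, h.map_sup, ret_pow h, ret_pow h, h2]
  exact ⟨rpow a (k+1), ⟨rpow b (k+1), rl_compl h5 (le_bot_iff.1 h4), h5⟩, ret_pow h a k⟩

end

/-- for a reticulation `(L, lam)` of a residuated lattice `A` and an
infinite cardinal `m`: `A` is `m`-Stone (for each `X ⊆ A` with `|X| ≤ m` there is a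
complemented `e` with `X^⊤ = <e>`) iff `L` is an `m`-Stone lattice (for each `Y ⊆ L`
with `|Y| ≤ m` there is a complemented `f` with `Y^⊤ = <f>`). -/
theorem stmt_16 {A L : Type u} [ResiduatedLattice A] [DistribLattice L] [BoundedOrder L]
    (lam : A → L) (h : IsReticulation lam) (m : Cardinal) (hm : Cardinal.aleph0 ≤ m) :
    (∀ X : Set A, Cardinal.mk X ≤ m → ∃ e ∈ BCenter A, coann X = rprinc e) ↔
    (∀ Y : Set L, Cardinal.mk Y ≤ m → ∃ f ∈ BCenter L, coann Y = Set.Ici f) := by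
  constructor
  · intro H Y hY
    obtain ⟨s, hs⟩ := h.surj.hasRightInverse
    obtain ⟨e, he, hX⟩ := H (s '' Y) (Cardinal.mk_image_le.trans hY)
    have hYs : lam '' (s '' Y) = Y := by
      rw [Set.image_image]; simp [hs _]
    refine ⟨lam e, ret_center h he, ?_⟩
    ext y
    obtain ⟨a, rfl⟩ := h.surj y
    rw [Set.mem_Ici, h.le_iff, ← hYs, ← ret_coann h, hX]
    rfl
  · intro H X hX
    obtain ⟨f, hf, hY⟩ := H (lam '' X) (Cardinal.mk_image_le.trans hX)
    obtain ⟨e, he, rfl⟩ := ret_lift h hf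
    refine ⟨e, he, ?_⟩
    ext a
    rw [ret_coann h, hY, Set.mem_Ici, h.le_iff]
    rfl
end

section
/- There exists a Stone residuated lattice A (in fact a 5-element one with ⊙ = ∧) containing an element a such that ¬a ∨ ¬¬a ≠ 1, where ¬x = x → 0. Consequently, Stone residuated lattices are not characterized by the identity ¬a ∨ ¬¬a = 1. -/
open ResiduatedLattice

abbrev Car18 : Type := WithTop (Bool × Bool)

def imp18 (a b : Car18) : Car18 :=
  if a ≤ b then ⊤ else
    match a, b with
    | none, b => b
    | some _, none => ⊤
    | some x, some y => ((x ⇨ y : Bool × Bool) : Car18)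

noncomputable instance inst18 : ResiduatedLattice Car18 where
  mul := fun a b => a ⊓ b
  himp := imp18
  mul_comm := inf_comm
  mul_assoc := inf_assoc
  mul_top := fun a => inf_top_eq a
  residuation := by decide +revert

/-- there exists a Stone residuated lattice — in fact a 5-element one in
which `⊙ = ∧` — containing an element `a` with `¬a ∨ ¬¬a ≠ 1` (where `¬x = x → 0`).
Hence Stone residuated lattices are not characterized by the identity `¬a ∨ ¬¬a = 1`. -/
theorem stmt_18 :
    ∃ A : RLPack, Nat.card A.carrier = 5 ∧
      (∀ x y : A.carrier, mul x y = x ⊓ y) ∧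
      (∀ a : A.carrier, ∃ e ∈ BCenter A.carrier, coann {a} = rprinc e) ∧
      ∃ a : A.carrier, himp a ⊥ ⊔ himp (himp a ⊥) ⊥ ≠ ⊤ := by
  refine ⟨⟨Car18⟩, ?_, fun x y => rfl, ?_, ?_⟩
  · show Nat.card Car18 = 5
    rw [Nat.card_eq_fintype_card]
    decide
  · intro a
    change Car18 at a
    have key : ∀ x y : Car18, x ⊔ y = ⊤ → y ≠ ⊤ → x = ⊤ := by decide
    by_cases ha : a = ⊤
    · refine ⟨(⊥ : Car18), ⟨(⊤ : Car18), bot_inf_eq _, sup_top_eq _⟩, ?_⟩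
      ext b
      constructor
      · intro _
        exact ⟨1, le_rfl, (inf_le_left : (⊥ : Car18) ⊓ _ ≤ ⊥).trans bot_le⟩
      · rintro - x rfl
        rw [ha]
        exact sup_top_eq _
    · refine ⟨(⊤ : Car18), ⟨(⊥ : Car18), top_inf_eq _, top_sup_eq _⟩, ?_⟩
      have hp : ∀ n : ℕ, rpow (⊤ : Car18) n = ⊤ := by
        intro n
        induction n with
        | zero => rfl
        | succ k ih => 
          show (⊤ : Car18) ⊓ rpow (⊤ : Car18) k = ⊤
          rw [ih]
          exact top_inf_eq _
      ext b
      constructor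
      · intro h
        have hb : b = (⊤ : Car18) := key b a (h a rfl) ha
        exact ⟨1, le_rfl, by rw [hb]; exact le_top⟩
      · rintro ⟨n, -, h⟩ x rfl
        have h' : (⊤ : Car18) ≤ b := by
          rw [← hp n]; exact h
        have hb : b = (⊤ : Car18) := top_le_iff.mp h'
        rw [hb]
        exact top_sup_eq _
  · refine ⟨((true, false) : Bool × Bool), ?_⟩
    show imp18 _ ⊥ ⊔ imp18 (imp18 _ ⊥) ⊥ ≠ (⊤ : Car18)
    decide
end

section
/- There exists a residuated lattice A (in fact a 12-element one) that satisfies the identity ¬a ∨ ¬¬a = 1 for all a ∈ A, where ¬x = x → 0, but is not a Stone residuated lattice (in the witnessing example, B(A) = {0, 1} while some element c satisfies c^⊤ = {d, 1}, which is not a principal filter generated by a complemented element). -/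
open ResiduatedLattice

/-- The order on `Fin 12`: a chain `0 < ... < 8` topped by two incomparable coatoms `9`, `10`
and the top `11`. -/
def wLe (a b : Fin 12) : Bool := decide (a ≤ b) && !(decide (a = 9) && decide (b = 10))

def wSup (a b : Fin 12) : Fin 12 := if wLe a b then b else if wLe b a then a else 11

def wInf (a b : Fin 12) : Fin 12 := if wLe a b then a else if wLe b a then b else 8

def wImp (a b : Fin 12) : Fin 12 :=
  if wLe a b then 11 else if a = 9 ∧ 8 ≤ b then 10 else if a = 10 ∧ 8 ≤ b then 9 else b

def W : Type := Fin 12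

instance : DecidableEq W := inferInstanceAs (DecidableEq (Fin 12))

instance : Fintype W := inferInstanceAs (Fintype (Fin 12))

def W.ofFin (a : Fin 12) : W := a

instance : ResiduatedLattice W where
  le a b := wLe a b = true
  le_refl := by change ∀ a : Fin 12, wLe a a = true; decide +kernel
  le_trans := by
    change ∀ a b c : Fin 12, wLe a b = true → wLe b c = true → wLe a c = true; decide +kernel
  le_antisymm := by
    change ∀ a b : Fin 12, wLe a b = true → wLe b a = true → a = b; decide +kernel
  sup := wSup
  inf := wInf
  le_sup_left := by change ∀ a b : Fin 12, wLe a (wSup a b) = true; decide +kernel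
  le_sup_right := by change ∀ a b : Fin 12, wLe b (wSup a b) = true; decide +kernel
  sup_le := by
    change ∀ a b c : Fin 12, wLe a c = true → wLe b c = true → wLe (wSup a b) c = true
    decide +kernel
  inf_le_left := by change ∀ a b : Fin 12, wLe (wInf a b) a = true; decide +kernel
  inf_le_right := by change ∀ a b : Fin 12, wLe (wInf a b) b = true; decide +kernel
  le_inf := by
    change ∀ a b c : Fin 12, wLe a b = true → wLe a c = true → wLe a (wInf b c) = true
    decide +kernel
  top := W.ofFin 11
  bot := W.ofFin 0
  le_top := by change ∀ a : Fin 12, wLe a 11 = true; decide +kernel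
  bot_le := by change ∀ a : Fin 12, wLe 0 a = true; decide +kernel
  mul := wInf
  himp := wImp
  mul_comm := by change ∀ a b : Fin 12, wInf a b = wInf b a; decide +kernel
  mul_assoc := by
    change ∀ a b c : Fin 12, wInf (wInf a b) c = wInf a (wInf b c); decide +kernel
  mul_top := by change ∀ a : Fin 12, wInf a 11 = a; decide +kernel
  residuation := by
    change ∀ a b c : Fin 12, wLe a (wImp b c) = true ↔ wLe (wInf a b) c = true; decide +kernel

theorem W_bcenter : BCenter W = {⊥, ⊤} := by
  ext e
  change (∃ f : W, e ⊓ f = ⊥ ∧ e ⊔ f = ⊤) ↔ (e = ⊥ ∨ e = ⊤)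
  revert e
  change ∀ e : Fin 12, (∃ f : Fin 12, wInf e f = 0 ∧ wSup e f = 11) ↔ (e = 0 ∨ e = 11)
  decide +kernel

theorem W_coann : coann {W.ofFin 9} = ({W.ofFin 10, ⊤} : Set W) := by
  ext e
  simp only [coann, Set.mem_setOf_eq, Set.mem_singleton_iff, forall_eq, Set.mem_insert_iff]
  revert e
  change ∀ e : Fin 12, wSup e 9 = 11 ↔ (e = 10 ∨ e = 11)
  decide +kernel

theorem W_not_stone : ¬ (∀ a : W, ∃ e ∈ BCenter W, coann {a} = rprinc e) := by
  intro h
  obtain ⟨e, he, h⟩ := h (W.ofFin 9)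
  rw [W_coann] at h
  rw [W_bcenter] at he
  rcases he with rfl | he
  · have hb : (⊥ : W) ∈ rprinc (⊥ : W) := by
      refine ⟨1, le_rfl, ?_⟩
      change wLe (wInf 0 11) 0 = true
      decide +kernel
    rw [← h] at hb
    have : ¬ ((0 : Fin 12) = 10 ∨ (0 : Fin 12) = 11) := by decide
    exact this hb
  · have he : e = ⊤ := he
    subst he
    have hp : ∀ n, rpow (⊤ : W) n = ⊤ := by
      intro n
      induction n with
      | zero => rfl
      | succ n ih => rw [rpow, ih, mul_top]
    have hd : W.ofFin 10 ∈ rprinc (⊤ : W) := by rw [← h]; exact Or.inl rfl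
    obtain ⟨n, -, hn⟩ := hd
    rw [hp] at hn
    have : ¬ (wLe 11 10 = true) := by decide
    exact this hn

/-- there exists a residuated lattice — in fact a 12-element one — which
satisfies the identity `¬a ∨ ¬¬a = 1` for all `a` (where `¬x = x → 0`) but is not
Stone: its Boolean center is `{0, 1}` while some element `c` has co-annihilator
`{d, 1}` with `d ≠ 1`, and `c^⊤` is not a principal filter generated by a
complemented element. -/
theorem stmt_19 :
    ∃ A : RLPack, Nat.card A.carrier = 12 ∧
      (∀ a : A.carrier, himp a ⊥ ⊔ himp (himp a ⊥) ⊥ = ⊤) ∧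
      BCenter A.carrier = {⊥, ⊤} ∧
      (∃ c d : A.carrier, d ≠ ⊤ ∧ coann {c} = ({d, ⊤} : Set A.carrier)) ∧
      ¬ (∀ a : A.carrier, ∃ e ∈ BCenter A.carrier, coann {a} = rprinc e) := by
  refine ⟨⟨W⟩, ?_, ?_, W_bcenter, ⟨W.ofFin 9, W.ofFin 10, ?_, W_coann⟩, W_not_stone⟩
  · change Nat.card (Fin 12) = 12
    simp
  · change ∀ a : Fin 12, wSup (wImp a 0) (wImp (wImp a 0) 0) = 11
    decide +kernel
  · change ¬ ((10 : Fin 12) = 11)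
    decide
end
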